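/- arXiv:2106.12653 — 5 statements merged into one kernel-verified Lean document; each statement's English description precedes it below -/
import Mathlib

section
/- Let X be a real normed space, X' its continuous dual with duality pairing ⟨·,·⟩, D ⊆ X an open set, and A : D → X'. Fix c > 0 and 2 ≤ q < 3, and assume ⟨A(u+h) − A(u), h⟩ ≥ c‖h‖_X^q for all u, u+h ∈ D. Suppose there is a map A' : D → L(X, X') and a constant M > 0 such that for every u ∈ D there exists r = r(u) > 0 with: for all h ∈ X with ‖h‖_X < r and u + h ∈ D, one can write ⟨A(u+h) − A(u), h⟩ = ⟨A'(u)h, h⟩ + ⟨w(u,h), h⟩ for some w(u,h) ∈ X' with ‖w(u,h)‖_{X'} ≤ M‖h‖_X². Then for each u ∈ D the linear operator A'(u) is strongly monotone with exponent 2: there exists c̃ > 0 such that ⟨A'(u)h, h⟩ ≥ c̃‖h‖_X² for all h ∈ X. -/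
/-- a strongly monotone map (with exponent `2 ≤ q < 3`) on an open
set whose Fréchet-type expansion has a quadratically bounded remainder has a
(strongly) monotone derivative with exponent 2. -/
theorem inherited_coercivity
    {X : Type*} [NormedAddCommGroup X] [NormedSpace ℝ X]
    (D : Set X) (hD : IsOpen D)
    (A : X → (X →L[ℝ] ℝ)) (A' : X → (X →L[ℝ] (X →L[ℝ] ℝ)))
    (c : ℝ) (hc : 0 < c) (q : ℝ) (hq1 : 2 ≤ q) (hq2 : q < 3)
    (hmono : ∀ u h : X, u ∈ D → u + h ∈ D → c * ‖h‖ ^ q ≤ (A (u + h) - A u) h)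
    (M : ℝ) (hM : 0 < M)
    (hexp : ∀ u ∈ D, ∃ r > 0, ∀ h : X, ‖h‖ < r → u + h ∈ D →
      ∃ w : X →L[ℝ] ℝ, (A (u + h) - A u) h = (A' u h) h + w h ∧ ‖w‖ ≤ M * ‖h‖ ^ 2) :
    ∀ u ∈ D, ∃ ctilde > 0, ∀ h : X, ctilde * ‖h‖ ^ 2 ≤ (A' u h) h := by
  intro u hu
  obtain ⟨r, hr, hexp_u⟩ := hexp u hu
  obtain ⟨ε, hε, hball⟩ := Metric.isOpen_iff.1 hD u hu
  have hq3 : 0 < 3 - q := by linarith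
  have hcM : 0 < c / (2 * M) := by positivity
  have hlim : Filter.Tendsto (fun t : ℝ => t ^ (3 - q)) (nhdsWithin 0 (Set.Ioi 0)) (nhds 0) := by
    have h := (Real.continuousAt_rpow_const 0 (3 - q) (Or.inr hq3.le)).tendsto
    rw [Real.zero_rpow hq3.ne'] at h
    exact h.mono_left nhdsWithin_le_nhds
  obtain ⟨t, htM, ⟨ht, htr⟩, -, htε⟩ := ((hlim.eventually (gt_mem_nhds hcM)).and
    ((Filter.Eventually.and (Ioo_mem_nhdsGT hr) (Ioo_mem_nhdsGT hε)))).exists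
  have htq : 0 < t ^ q := Real.rpow_pos_of_pos ht q
  have hcube : M * t ^ 3 ≤ c / 2 * t ^ q := by
    have hsplit : t ^ 3 = t ^ (3 - q) * t ^ q := by
      rw [← Real.rpow_add ht, sub_add_cancel]
      norm_cast
    rw [lt_div_iff₀ (by positivity)] at htM
    rw [hsplit]
    nlinarith
  have hsphere : ∀ g : X, ‖g‖ = t → c / 2 * t ^ q ≤ (A' u g) g := by
    intro g hg
    have hmem : u + g ∈ D := hball (by simpa [hg] using htε)
    obtain ⟨w, hw, hwn⟩ := hexp_u g (hg ▸ htr) hmem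
    have hm := hmono u g hu hmem
    have hwg : w g ≤ M * t ^ 3 := by
      calc w g ≤ ‖w g‖ := Real.le_norm_self _
        _ ≤ ‖w‖ * ‖g‖ := w.le_opNorm g
        _ ≤ M * ‖g‖ ^ 2 * ‖g‖ := by gcongr
        _ = M * t ^ 3 := by rw [hg]; ring
    rw [hg] at hm
    linarith
  refine ⟨c / 2 * t ^ q / t ^ 2, by positivity, fun h => ?_⟩
  rcases eq_or_ne h 0 with rfl | hne
  · simp
  have hn : 0 < ‖h‖ := norm_pos_iff.2 hne
  have hs := hsphere ((t / ‖h‖) • h) (by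
    rw [norm_smul, Real.norm_of_nonneg (by positivity), div_mul_cancel₀ _ hn.ne'])
  simp only [map_smul, smul_apply, smul_eq_mul] at hs
  calc c / 2 * t ^ q / t ^ 2 * ‖h‖ ^ 2
      ≤ (t / ‖h‖ * (t / ‖h‖ * (A' u h) h)) / t ^ 2 * ‖h‖ ^ 2 := by gcongr
    _ = (A' u h) h := by field_simp
end

section
/- Let X be a real normed space, X' its continuous dual with duality pairing ⟨·,·⟩, D ⊆ X an open set, and F : D → X' a monotone map, i.e. ⟨F(u+h) − F(u), h⟩ ≥ 0 whenever u, u+h ∈ D. Let u ∈ D and suppose F is Newton differentiable at u with Newton derivative G_F : N(u) → L(X, X') on a neighborhood N(u) ⊆ D of u. If for each fixed h ∈ X the map w ↦ ⟨G_F(w)h, h⟩ is continuous at w = u, then G_F(u) is monotone: ⟨G_F(u)h, h⟩ ≥ 0 for all h ∈ X. -/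
/-- if a monotone map `F` on an open set `D` is Newton
differentiable at `u ∈ D` with Newton derivative `G_F` (defined on a
neighborhood `N ⊆ D` of `u`), and `w ↦ ⟨G_F(w)h, h⟩` is continuous at `u` for
each `h`, then `G_F(u)` is monotone. -/
theorem newton_derivative_monotone
    {X : Type*} [NormedAddCommGroup X] [NormedSpace ℝ X]
    (D : Set X) (hD : IsOpen D)
    (F : X → (X →L[ℝ] ℝ)) (GF : X → (X →L[ℝ] (X →L[ℝ] ℝ)))
    (hFmono : ∀ u h : X, u ∈ D → u + h ∈ D → 0 ≤ (F (u + h) - F u) h)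
    (u : X) (hu : u ∈ D)
    (N : Set X) (hN : N ∈ nhds u) (hND : N ⊆ D)
    (hnewton : ∀ ε > 0, ∃ δ > 0, ∀ h : X, ‖h‖ < δ → u + h ∈ N →
      ‖F (u + h) - F u - GF (u + h) h‖ ≤ ε * ‖h‖)
    (hcont : ∀ h : X, ContinuousAt (fun w => (GF w h) h) u) :
    ∀ h : X, 0 ≤ (GF u h) h := by
  intro h
  have hline : Filter.Tendsto (fun t : ℝ => u + t • h) (nhdsWithin 0 (Set.Ioi 0)) (nhds u) := by
    have hc : Continuous fun t : ℝ => u + t • h := by fun_prop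
    simpa using (hc.tendsto 0).mono_left nhdsWithin_le_nhds
  have hlower : ∀ ε > 0, -(ε * ‖h‖ ^ 2) ≤ (GF u h) h := by
    intro ε hε
    obtain ⟨δ, hδ, hδN⟩ := hnewton ε hε
    refine ge_of_tendsto ((hcont h).tendsto.comp hline) ?_
    filter_upwards [hline.eventually hN, hline.eventually (Metric.ball_mem_nhds u hδ),
      self_mem_nhdsWithin] with t htN htδ ht
    have ht : 0 < t := ht
    have hrem := hδN (t • h) (by simpa [dist_eq_norm] using htδ) htN
    have hmono := hFmono u (t • h) hu (hND htN)
    have hle := (Real.le_norm_self _).trans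
      ((F (u + t • h) - F u - GF (u + t • h) (t • h)).le_of_opNorm_le hrem (t • h))
    rw [sub_apply] at hle
    simp only [map_smul, smul_apply, smul_eq_mul, norm_smul,
      Real.norm_of_nonneg ht.le] at hle hmono
    have hscaled : 0 ≤ t ^ 2 * ((GF (u + t • h) h) h + ε * ‖h‖ ^ 2) := by nlinarith
    have := nonneg_of_mul_nonneg_right hscaled (by positivity)
    simp only [Function.comp_apply]
    linarith
  have hlim : Filter.Tendsto (fun ε : ℝ => -(ε * ‖h‖ ^ 2)) (nhdsWithin 0 (Set.Ioi 0))
      (nhds 0) := by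
    have hc : Continuous fun ε : ℝ => -(ε * ‖h‖ ^ 2) := by fun_prop
    simpa using (hc.tendsto 0).mono_left nhdsWithin_le_nhds
  exact le_of_tendsto hlim (by filter_upwards [self_mem_nhdsWithin] with ε hε using hlower ε hε)
end

section
/- Let Ω ⊂ ℝ^d be a measurable set of finite Lebesgue measure, let ν > 0, and let φ : Ω → ℝ be measurable with φ(x) ≥ ν for a.e. x ∈ Ω. Let 2 ≤ 2q ≤ p < ∞. For x ∈ Ω define P_x : ℝ^d → ℝ^d by P_x(a) = (|a| − φ(x))^± · a/|a| for a ≠ 0 and P_x(0) = 0, where t^± := min(1, max(0, t)) and |·| is the Euclidean norm. Then the superposition operator P : L^p(Ω; ℝ^d) → L^q(Ω; ℝ^d), (P(u))(x) = P_x(u(x)), is well defined and Newton differentiable, with Newton derivative G_P given pointwise, for u(x) ≠ 0, by (G_P(u)h)(x) = χ_{(0,1)}(|u(x)| − φ(x)) · (u(x)·h(x)/|u(x)|²) u(x) + (|u(x)| − φ(x))^± · (1/|u(x)|)( h(x) − (u(x)·h(x)/|u(x)|²) u(x) ), and (G_P(u)h)(x) = 0 where u(x) = 0; that is, each G_P(u)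 is a bounded linear operator from L^p(Ω; ℝ^d) to L^q(Ω; ℝ^d) and ‖P(u+h) − P(u) − G_P(u+h)h‖_{L^q} / ‖h‖_{L^p} → 0 as ‖h‖_{L^p} → 0, for every u ∈ L^p(Ω; ℝ^d). -/
open MeasureTheory RealInnerProductSpace Classical
open scoped ENNReal

/-- The pointwise regularization vector field `P_x(a) = (|a| − φ(x))^± a/|a|`
(and `P_x(0) = 0`), where `t^± = min(1, max(0, t))`; here `φx = φ(x)`. -/
noncomputable def Pvec {d : ℕ} (φx : ℝ) (a : EuclideanSpace ℝ (Fin d)) :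
    EuclideanSpace ℝ (Fin d) :=
  if a = 0 then 0 else (min 1 (max 0 (‖a‖ - φx))) • (‖a‖⁻¹ • a)

/-- The pointwise Newton derivative of `P_x`: for `a ≠ 0`,
`χ_{(0,1)}(|a| − φx) (a·h/|a|²) a + (|a| − φx)^± (1/|a|)(h − (a·h/|a|²) a)`,
and `0` for `a = 0`. -/
noncomputable def GPvec {d : ℕ} (φx : ℝ) (a h : EuclideanSpace ℝ (Fin d)) :
    EuclideanSpace ℝ (Fin d) :=
  if a = 0 then 0 else
    (Set.indicator (Set.Ioo (0 : ℝ) 1) (fun _ => (1 : ℝ)) (‖a‖ - φx)) •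
        ((⟪a, h⟫ / ‖a‖ ^ 2) • a) +
      (min 1 (max 0 (‖a‖ - φx))) • (‖a‖⁻¹ • (h - (⟪a, h⟫ / ‖a‖ ^ 2) • a))

/-- The scalar ramp `min(1, max(0, t - c))`. -/
noncomputable def ramp (c t : ℝ) : ℝ := min 1 (max 0 (t - c))

/-- The a.e. derivative of `ramp c`, with value `0` at the kinks. -/
noncomputable def rampSlope (c t : ℝ) : ℝ :=
  Set.indicator (Set.Ioo (0 : ℝ) 1) (fun _ => (1 : ℝ)) (t - c)

/-- The distance from `t` to the nearest kink of `ramp c` other than `t` itself. -/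
noncomputable def kinkDist (c t : ℝ) : ℝ :=
  if t = c ∨ t = c + 1 then 1 else min |t - c| |t - c - 1|

theorem kinkDist_pos (c t : ℝ) : 0 < kinkDist c t := by
  unfold kinkDist
  split_ifs with h
  · norm_num
  · push Not at h
    exact lt_min (abs_pos.2 (sub_ne_zero.2 h.1))
      (abs_pos.2 fun h' => h.2 (by linarith))

theorem ramp_nonneg (c t : ℝ) : 0 ≤ ramp c t :=
  le_min zero_le_one (le_max_left _ _)

theorem ramp_le_one (c t : ℝ) : ramp c t ≤ 1 := min_le_left _ _

theorem ramp_eq_zero {c t : ℝ} (h : t ≤ c) : ramp c t = 0 := by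
  unfold ramp
  rw [max_eq_left (by linarith), min_eq_right zero_le_one]

theorem ramp_of_mem {c t : ℝ} (h₁ : c ≤ t) (h₂ : t ≤ c + 1) : ramp c t = t - c := by
  unfold ramp
  rw [max_eq_right (by linarith), min_eq_right (by linarith)]

theorem ramp_eq_one {c t : ℝ} (h : c + 1 ≤ t) : ramp c t = 1 := by
  unfold ramp
  rw [max_eq_right (by linarith), min_eq_left (by linarith)]

theorem rampSlope_of_mem {c t : ℝ} (h₁ : c < t) (h₂ : t < c + 1) : rampSlope c t = 1 :=
  Set.indicator_of_mem (by constructor <;> linarith) _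

theorem rampSlope_eq_zero_of_le {c t : ℝ} (h : t ≤ c) : rampSlope c t = 0 :=
  Set.indicator_of_notMem (fun h' => by linarith [h'.1]) _

theorem rampSlope_eq_zero_of_ge {c t : ℝ} (h : c + 1 ≤ t) : rampSlope c t = 0 :=
  Set.indicator_of_notMem (fun h' => by linarith [h'.2]) _

theorem rampSlope_nonneg (c t : ℝ) : 0 ≤ rampSlope c t :=
  Set.indicator_nonneg (fun _ _ => zero_le_one) _

theorem rampSlope_le_one (c t : ℝ) : rampSlope c t ≤ 1 :=
  Set.indicator_le_self' (fun _ _ => zero_le_one) _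

theorem abs_ramp_sub_le (c s t : ℝ) : |ramp c t - ramp c s| ≤ |t - s| := by
  unfold ramp
  calc |min 1 (max 0 (t - c)) - min 1 (max 0 (s - c))|
      ≤ |max 0 (t - c) - max 0 (s - c)| := by
        simpa using abs_min_sub_min_le_max 1 (max 0 (t - c)) 1 (max 0 (s - c))
    _ ≤ |(t - c) - (s - c)| := by
        simpa using abs_max_sub_max_le_max 0 (t - c) 0 (s - c)
    _ = |t - s| := by congr 1; ring

theorem abs_ramp_remainder_le (c s t : ℝ) :
    |ramp c t - ramp c s - rampSlope c t * (t - s)| ≤ 2 * |t - s| := by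
  have h₁ := abs_ramp_sub_le c s t
  have h₂ : |rampSlope c t * (t - s)| ≤ |t - s| := by
    rw [abs_mul, abs_of_nonneg (rampSlope_nonneg c t)]
    exact mul_le_of_le_one_left (abs_nonneg _) (rampSlope_le_one c t)
  linarith [abs_sub (ramp c t - ramp c s) (rampSlope c t * (t - s))]

theorem ramp_remainder_eq_zero {c s t : ℝ} (h : |t - s| < kinkDist c s) :
    ramp c t - ramp c s - rampSlope c t * (t - s) = 0 := by
  unfold kinkDist at h
  have hb := abs_lt.1 h
  rcases le_or_gt t c with ht | ht
  · rw [ramp_eq_zero ht, rampSlope_eq_zero_of_le ht]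
    rcases le_or_gt s c with hs | hs
    · rw [ramp_eq_zero hs]; ring
    · exfalso
      split_ifs at h hb with h'
      · rcases h' with h' | h' <;> linarith
      · have := (min_le_left |s - c| |s - c - 1|)
        rw [abs_of_pos (by linarith : 0 < s - c)] at *
        linarith
  rcases le_or_gt (c + 1) t with ht' | ht'
  · rw [ramp_eq_one ht', rampSlope_eq_zero_of_ge ht']
    rcases le_or_gt (c + 1) s with hs | hs
    · rw [ramp_eq_one hs]; ring
    · exfalso
      split_ifs at h hb with h'
      · rcases h' with h' | h' <;> linarith
      · have := (min_le_right |s - c| |s - c - 1|)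
        rw [abs_of_neg (by linarith : s - c - 1 < 0)] at *
        linarith
  rw [ramp_of_mem ht.le ht'.le, rampSlope_of_mem ht ht']
  rcases lt_or_ge s c with hs | hs
  · exfalso
    rw [if_neg (by rintro (h | h) <;> linarith)] at hb
    have := (min_le_left |s - c| |s - c - 1|)
    rw [abs_of_neg (by linarith : s - c < 0)] at *
    linarith
  rcases lt_or_ge (c + 1) s with hs' | hs'
  · exfalso
    rw [if_neg (by rintro (h | h) <;> linarith)] at hb
    have := (min_le_right |s - c| |s - c - 1|)
    rw [abs_of_pos (by linarith : 0 < s - c - 1)] at *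
    linarith
  rw [ramp_of_mem hs hs']; ring

section Direction

variable {E : Type*} [NormedAddCommGroup E] [InnerProductSpace ℝ E]

theorem norm_inv_norm_smul_le_one (a : E) : ‖‖a‖⁻¹ • a‖ ≤ 1 := by
  rw [norm_smul, norm_inv, norm_norm]
  exact inv_mul_le_one

theorem norm_smul_inv_norm_smul (a : E) : ‖a‖ • (‖a‖⁻¹ • a) = a := by
  rcases eq_or_ne a 0 with rfl | ha
  · simp
  · rw [smul_inv_smul₀ (norm_ne_zero_iff.2 ha)]

theorem norm_direction_sub_le (a : E) {b : E} (hb : b ≠ 0) :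
    ‖‖b‖⁻¹ • b - ‖a‖⁻¹ • a‖ ≤ 2 * ‖b - a‖ / ‖b‖ := by
  have hβ : 0 < ‖b‖ := norm_pos_iff.2 hb
  have key : ‖b‖ • (‖b‖⁻¹ • b - ‖a‖⁻¹ • a) = (b - a) - (‖b‖ - ‖a‖) • (‖a‖⁻¹ • a) := by
    rw [smul_sub, sub_smul, norm_smul_inv_norm_smul, norm_smul_inv_norm_smul]; abel
  rw [le_div_iff₀ hβ, mul_comm]
  calc ‖b‖ * ‖‖b‖⁻¹ • b - ‖a‖⁻¹ • a‖ = ‖(b - a) - (‖b‖ - ‖a‖) • (‖a‖⁻¹ • a)‖ := by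
        rw [← key, norm_smul, norm_norm]
    _ ≤ ‖b - a‖ + |‖b‖ - ‖a‖| * ‖‖a‖⁻¹ • a‖ := by
        refine (norm_sub_le _ _).trans ?_
        rw [norm_smul, Real.norm_eq_abs]
    _ ≤ ‖b - a‖ + ‖b - a‖ * 1 := by
        gcongr
        · exact abs_norm_sub_norm_le b a
        · exact norm_inv_norm_smul_le_one a
    _ = 2 * ‖b - a‖ := by ring

theorem inner_sub_right_eq_norm (a b : E) :
    ⟪b, b - a⟫ = ((‖b‖ - ‖a‖) * (‖b‖ + ‖a‖) + ‖b - a‖ ^ 2) / 2 := by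
  have h := norm_sub_sq_real b a
  rw [inner_sub_right, real_inner_self_eq_norm_sq]
  linarith

/-- Second order estimate for the map `b ↦ b / ‖b‖`, linearized at the endpoint. -/
theorem norm_direction_remainder_le (a : E) {b : E} (hb : b ≠ 0) :
    ‖‖b‖⁻¹ • b - ‖a‖⁻¹ • a - ‖b‖⁻¹ • ((b - a) - (⟪b, b - a⟫ / ‖b‖ ^ 2) • b)‖
      ≤ 3 * ‖b - a‖ ^ 2 / ‖b‖ ^ 2 := by
  have hβ : 0 < ‖b‖ := norm_pos_iff.2 hb
  have hβ' := hβ.ne'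
  have hnb := norm_inv_norm_smul_le_one b
  have hab := abs_norm_sub_norm_le b a
  have hd := norm_direction_sub_le a hb
  have key : ‖b‖⁻¹ • b - ‖a‖⁻¹ • a - ‖b‖⁻¹ • ((b - a) - (⟪b, b - a⟫ / ‖b‖ ^ 2) • b) =
      (‖b - a‖ ^ 2 / (2 * ‖b‖ ^ 2)) • (‖b‖⁻¹ • b) +
      ((‖b‖ - ‖a‖) / ‖b‖) • ((‖b‖⁻¹ • b - ‖a‖⁻¹ • a) -
        ((‖b‖ - ‖a‖) / (2 * ‖b‖)) • (‖b‖⁻¹ • b)) := by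
    rw [inner_sub_right_eq_norm]
    have ea := (norm_smul_inv_norm_smul a).symm
    generalize ‖b - a‖ = η
    generalize ‖a‖⁻¹ • a = n at *
    generalize ‖a‖ = α at *
    subst ea
    match_scalars <;> field_simp <;> ring
  rw [key]
  have h₁ : ‖(‖b‖⁻¹ • b - ‖a‖⁻¹ • a) - ((‖b‖ - ‖a‖) / (2 * ‖b‖)) • (‖b‖⁻¹ • b)‖ ≤
      2 * ‖b - a‖ / ‖b‖ + ‖b - a‖ / (2 * ‖b‖) * 1 := by
    refine (norm_sub_le _ _).trans (add_le_add hd ?_)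
    rw [norm_smul, Real.norm_eq_abs, abs_div, abs_of_pos (by positivity : 0 < 2 * ‖b‖)]
    gcongr
  calc _ ≤ ‖b - a‖ ^ 2 / (2 * ‖b‖ ^ 2) * 1 + ‖b - a‖ / ‖b‖ *
        (2 * ‖b - a‖ / ‖b‖ + ‖b - a‖ / (2 * ‖b‖) * 1) := by
        refine (norm_add_le _ _).trans (add_le_add ?_ ?_)
        · rw [norm_smul, Real.norm_eq_abs, abs_of_nonneg (by positivity)]
          gcongr
        · rw [norm_smul, Real.norm_eq_abs, abs_div, abs_of_pos hβ]
          gcongr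
    _ = 3 * ‖b - a‖ ^ 2 / ‖b‖ ^ 2 := by field_simp; ring

theorem norm_radial_remainder_le (a : E) {b : E} (hb : b ≠ 0) :
    ‖(‖b‖ - ‖a‖) • (‖a‖⁻¹ • a) - (⟪b, b - a⟫ / ‖b‖ ^ 2) • b‖ ≤ 3 * ‖b - a‖ ^ 2 / ‖b‖ := by
  have hβ : 0 < ‖b‖ := norm_pos_iff.2 hb
  have hβ' := hβ.ne'
  have hnb := norm_inv_norm_smul_le_one b
  have hab := abs_norm_sub_norm_le b a
  have hd := norm_direction_sub_le a hb
  have key : (‖b‖ - ‖a‖) • (‖a‖⁻¹ • a) - (⟪b, b - a⟫ / ‖b‖ ^ 2) • b =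
      -((‖b‖ - ‖a‖) • (‖b‖⁻¹ • b - ‖a‖⁻¹ • a)) +
      (((‖b‖ - ‖a‖) ^ 2 - ‖b - a‖ ^ 2) / (2 * ‖b‖)) • (‖b‖⁻¹ • b) := by
    rw [inner_sub_right_eq_norm]
    match_scalars <;> field_simp
    ring
  have hsq : |(‖b‖ - ‖a‖) ^ 2 - ‖b - a‖ ^ 2| ≤ ‖b - a‖ ^ 2 := by
    have h := sq_le_sq' (by linarith [abs_le.1 hab |>.1]) (abs_le.1 hab |>.2)
    rw [abs_le]
    constructor <;> nlinarith [sq_nonneg (‖b‖ - ‖a‖)]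
  rw [key]
  calc _ ≤ ‖b - a‖ * (2 * ‖b - a‖ / ‖b‖) + ‖b - a‖ ^ 2 / (2 * ‖b‖) * 1 := by
        refine (norm_add_le _ _).trans (add_le_add ?_ ?_)
        · rw [norm_neg, norm_smul, Real.norm_eq_abs]
          gcongr
        · rw [norm_smul, Real.norm_eq_abs, abs_div, abs_of_pos (by positivity : 0 < 2 * ‖b‖)]
          gcongr
    _ ≤ 3 * ‖b - a‖ ^ 2 / ‖b‖ := by
        rw [← sub_nonneg]
        have : 3 * ‖b - a‖ ^ 2 / ‖b‖ - (‖b - a‖ * (2 * ‖b - a‖ / ‖b‖) +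
            ‖b - a‖ ^ 2 / (2 * ‖b‖) * 1) = ‖b - a‖ ^ 2 / (2 * ‖b‖) := by
          field_simp; ring
        rw [this]; positivity

end Direction

section Pointwise

variable {d : ℕ}

theorem Pvec_eq (c : ℝ) (a : EuclideanSpace ℝ (Fin d)) :
    Pvec c a = ramp c ‖a‖ • (‖a‖⁻¹ • a) := by
  unfold Pvec ramp
  split_ifs with h
  · simp [h]
  · rfl

theorem GPvec_eq (c : ℝ) (a h : EuclideanSpace ℝ (Fin d)) :
    GPvec c a h = rampSlope c ‖a‖ • ((⟪a, h⟫ / ‖a‖ ^ 2) • a) +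
      ramp c ‖a‖ • (‖a‖⁻¹ • (h - (⟪a, h⟫ / ‖a‖ ^ 2) • a)) := by
  unfold GPvec ramp rampSlope
  split_ifs with h
  · simp [h]
  · rfl

theorem GPvec_add (c : ℝ) (a h k : EuclideanSpace ℝ (Fin d)) :
    GPvec c a (h + k) = GPvec c a h + GPvec c a k := by
  simp only [GPvec_eq, inner_add_right]
  module

theorem GPvec_smul (c r : ℝ) (a h : EuclideanSpace ℝ (Fin d)) :
    GPvec c a (r • h) = r • GPvec c a h := by
  simp only [GPvec_eq, inner_smul_right]
  module

theorem norm_Pvec_le_one (c : ℝ) (a : EuclideanSpace ℝ (Fin d)) : ‖Pvec c a‖ ≤ 1 := by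
  rw [Pvec_eq, norm_smul, Real.norm_of_nonneg (ramp_nonneg _ _)]
  exact mul_le_one₀ (ramp_le_one _ _) (norm_nonneg _) (norm_inv_norm_smul_le_one a)

theorem norm_proj_le (a h : EuclideanSpace ℝ (Fin d)) :
    ‖(⟪a, h⟫ / ‖a‖ ^ 2) • a‖ ≤ ‖h‖ := by
  rcases eq_or_ne a 0 with rfl | ha
  · simp
  have hα : 0 < ‖a‖ := norm_pos_iff.2 ha
  rw [norm_smul, Real.norm_eq_abs, abs_div, abs_of_pos (by positivity : 0 < ‖a‖ ^ 2)]
  calc |⟪a, h⟫| / ‖a‖ ^ 2 * ‖a‖ ≤ ‖a‖ * ‖h‖ / ‖a‖ ^ 2 * ‖a‖ := by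
        gcongr
        exact abs_real_inner_le_norm a h
    _ = ‖h‖ := by field_simp

theorem norm_GPvec_le {ν c : ℝ} (hν : 0 < ν) (hc : ν ≤ c) (a h : EuclideanSpace ℝ (Fin d)) :
    ‖GPvec c a h‖ ≤ (1 + 2 / ν) * ‖h‖ := by
  rw [GPvec_eq]
  have hp := norm_proj_le a h
  have h₁ : ‖rampSlope c ‖a‖ • ((⟪a, h⟫ / ‖a‖ ^ 2) • a)‖ ≤ 1 * ‖h‖ := by
    rw [norm_smul, Real.norm_of_nonneg (rampSlope_nonneg _ _)]
    gcongr
    exact rampSlope_le_one _ _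
  have h₂ : ‖ramp c ‖a‖ • (‖a‖⁻¹ • (h - (⟪a, h⟫ / ‖a‖ ^ 2) • a))‖ ≤ 2 / ν * ‖h‖ := by
    rcases le_or_gt ‖a‖ c with ha | ha
    · rw [ramp_eq_zero ha, zero_smul, norm_zero]; positivity
    · rw [norm_smul, Real.norm_of_nonneg (ramp_nonneg _ _), norm_smul, norm_inv, norm_norm]
      calc ramp c ‖a‖ * (‖a‖⁻¹ * ‖h - (⟪a, h⟫ / ‖a‖ ^ 2) • a‖) ≤ 1 * (ν⁻¹ * (‖h‖ + ‖h‖)) := by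
            gcongr
            · exact ramp_le_one _ _
            · linarith
            · exact (norm_sub_le _ _).trans (by gcongr)
        _ = 2 / ν * ‖h‖ := by ring
  calc _ ≤ _ := norm_add_le _ _
    _ ≤ _ := by linarith

/-- The pointwise Newton remainder is quadratic in the increment, except for a linear term that
occurs only when the increment is large enough to reach a kink. -/
theorem norm_Pvec_remainder_le {ν c : ℝ} (hν : 0 < ν) (hc : ν ≤ c)
    (a h : EuclideanSpace ℝ (Fin d)) :
    ‖Pvec c (a + h) - Pvec c a - GPvec c (a + h) h‖ ≤
      (3 / ν ^ 2 + 3 / ν) * ‖h‖ ^ 2 + 2 * (if kinkDist c ‖a‖ ≤ ‖h‖ then ‖h‖ else 0) := by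
  obtain ⟨b, rfl⟩ : ∃ b, h = b - a := ⟨a + h, by abel⟩
  rw [add_sub_cancel, Pvec_eq, Pvec_eq, GPvec_eq]
  have key : ramp c ‖b‖ • (‖b‖⁻¹ • b) - ramp c ‖a‖ • (‖a‖⁻¹ • a) -
      (rampSlope c ‖b‖ • ((⟪b, b - a⟫ / ‖b‖ ^ 2) • b) +
        ramp c ‖b‖ • (‖b‖⁻¹ • ((b - a) - (⟪b, b - a⟫ / ‖b‖ ^ 2) • b))) =
      ramp c ‖b‖ • (‖b‖⁻¹ • b - ‖a‖⁻¹ • a -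
        ‖b‖⁻¹ • ((b - a) - (⟪b, b - a⟫ / ‖b‖ ^ 2) • b)) +
      rampSlope c ‖b‖ • ((‖b‖ - ‖a‖) • (‖a‖⁻¹ • a) - (⟪b, b - a⟫ / ‖b‖ ^ 2) • b) +
      (ramp c ‖b‖ - ramp c ‖a‖ - rampSlope c ‖b‖ * (‖b‖ - ‖a‖)) • (‖a‖⁻¹ • a) := by
    module
  rw [key]
  have hab := abs_norm_sub_norm_le b a
  have h₃ : ‖(ramp c ‖b‖ - ramp c ‖a‖ - rampSlope c ‖b‖ * (‖b‖ - ‖a‖)) • (‖a‖⁻¹ • a)‖ ≤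
      2 * (if kinkDist c ‖a‖ ≤ ‖b - a‖ then ‖b - a‖ else 0) := by
    rw [norm_smul, Real.norm_eq_abs]
    split_ifs with hk
    · calc _ ≤ (2 * ‖b - a‖) * 1 := by
            gcongr
            · exact (abs_ramp_remainder_le _ _ _).trans (by gcongr)
            · exact norm_inv_norm_smul_le_one a
        _ = _ := mul_one _
    · rw [ramp_remainder_eq_zero (hab.trans_lt (not_le.1 hk))]
      simp
  have h₁₂ : ‖ramp c ‖b‖ • (‖b‖⁻¹ • b - ‖a‖⁻¹ • a -
        ‖b‖⁻¹ • ((b - a) - (⟪b, b - a⟫ / ‖b‖ ^ 2) • b)) +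
      rampSlope c ‖b‖ • ((‖b‖ - ‖a‖) • (‖a‖⁻¹ • a) - (⟪b, b - a⟫ / ‖b‖ ^ 2) • b)‖ ≤
      (3 / ν ^ 2 + 3 / ν) * ‖b - a‖ ^ 2 := by
    rcases le_or_gt ‖b‖ c with hb | hb
    · rw [ramp_eq_zero hb, rampSlope_eq_zero_of_le hb, zero_smul, zero_smul, add_zero, norm_zero]
      positivity
    have hνb : ν ≤ ‖b‖ := by linarith
    have hb0 : b ≠ 0 := norm_pos_iff.1 (hν.trans_le hνb)
    calc _ ≤ 1 * (3 * ‖b - a‖ ^ 2 / ν ^ 2) + 1 * (3 * ‖b - a‖ ^ 2 / ν) := by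
          refine (norm_add_le _ _).trans (add_le_add ?_ ?_)
          · rw [norm_smul, Real.norm_of_nonneg (ramp_nonneg _ _)]
            gcongr
            · exact ramp_le_one _ _
            · exact (norm_direction_remainder_le a hb0).trans (by gcongr)
          · rw [norm_smul, Real.norm_of_nonneg (rampSlope_nonneg _ _)]
            gcongr
            · exact rampSlope_le_one _ _
            · exact (norm_radial_remainder_le a hb0).trans (by gcongr)
      _ = _ := by ring
  exact (norm_add_le _ _).trans (add_le_add h₁₂ h₃)

end Pointwise

section Lebesgue

variable {α : Type*} [MeasurableSpace α] {μ : Measure α}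
  {E : Type*} [NormedAddCommGroup E]

theorem tendsto_measure_le_norm_Lp [IsFiniteMeasure μ] {p : ℝ≥0∞} [Fact (1 ≤ p)] (hp : p ≠ ⊤)
    {κ : α → ℝ} (hκm : Measurable κ) (hκ : ∀ x, 0 < κ x) :
    Filter.Tendsto (fun h : Lp E p μ => μ {x | κ x ≤ ‖h x‖}) (nhds 0) (nhds 0) := by
  have hp0 : p ≠ 0 := (zero_lt_one.trans_le (Fact.out : 1 ≤ p)).ne'
  have hpr : 0 < p.toReal := ENNReal.toReal_pos hp0 hp
  have hκlim : Filter.Tendsto (fun r : ℝ => μ {x | κ x ≤ r}) (nhdsWithin 0 (Set.Ioi 0))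
      (nhds 0) := by
    have h := tendsto_measure_biInter_gt (μ := μ) (s := fun r : ℝ => {x | κ x ≤ r}) (a := 0)
      (fun r _ => (measurableSet_le hκm measurable_const).nullMeasurableSet)
      (fun i j _ hij x hx => le_trans hx hij) ⟨1, one_pos, measure_ne_top _ _⟩
    have hempty : (⋂ r : ℝ, ⋂ (_ : r > 0), {x | κ x ≤ r}) = ∅ := by
      refine Set.eq_empty_of_forall_notMem fun x hx => ?_
      have := Set.mem_iInter₂.1 hx (κ x / 2) (half_pos (hκ x))
      have h2 : κ x ≤ κ x / 2 := this
      linarith [hκ x]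
    rw [hempty, measure_empty] at h
    exact h
  rw [ENNReal.tendsto_nhds_zero]
  intro ε hε
  obtain ⟨r, hr, hr0⟩ := ((ENNReal.tendsto_nhds_zero.1 hκlim (ε / 2)
    (ENNReal.half_pos hε.ne')).and self_mem_nhdsWithin).exists
  have hr0 : 0 < r := hr0
  have hmarkov : Filter.Tendsto
      (fun h : Lp E p μ => (ENNReal.ofReal r)⁻¹ ^ p.toReal * ‖h‖ₑ ^ p.toReal)
      (nhds 0) (nhds 0) := by
    have h₁ : Filter.Tendsto (fun h : Lp E p μ => ‖h‖ₑ ^ p.toReal) (nhds 0) (nhds 0) := by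
      have := (ENNReal.continuous_rpow_const (y := p.toReal)).comp
        (continuous_enorm (E := Lp E p μ))
      simpa [Function.comp_def, ENNReal.zero_rpow_of_pos hpr] using this.tendsto 0
    have h₂ := ENNReal.Tendsto.const_mul (a := (ENNReal.ofReal r)⁻¹ ^ p.toReal) h₁ (Or.inr (by
      refine ENNReal.rpow_ne_top_of_nonneg hpr.le ?_
      simpa using hr0))
    simpa using h₂
  filter_upwards [ENNReal.tendsto_nhds_zero.1 hmarkov (ε / 2) (ENNReal.half_pos hε.ne')]
    with h hh
  calc μ {x | κ x ≤ ‖h x‖}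
      ≤ μ ({x | κ x ≤ r} ∪ {x | ENNReal.ofReal r ≤ ‖h x‖ₑ}) := by
        refine measure_mono fun x hx => ?_
        have hx : κ x ≤ ‖h x‖ := hx
        rcases le_total (‖h x‖) r with hxr | hxr
        · exact Or.inl (hx.trans hxr)
        · refine Or.inr ?_
          change ENNReal.ofReal r ≤ ‖h x‖ₑ
          rw [← ofReal_norm]
          exact ENNReal.ofReal_le_ofReal hxr
    _ ≤ μ {x | κ x ≤ r} + μ {x | ENNReal.ofReal r ≤ ‖h x‖ₑ} := measure_union_le _ _
    _ ≤ ε / 2 + ε / 2 := by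
        refine add_le_add hr (le_trans ?_ hh)
        rw [Lp.enorm_def]
        exact meas_ge_le_mul_pow_eLpNorm_enorm μ hp0 hp (Lp.aestronglyMeasurable h)
          (by simpa using hr0) (fun h => absurd h ENNReal.ofReal_ne_top)
    _ = ε := ENNReal.add_halves ε

theorem eLpNorm_indicator_le_mul_measure_rpow {p q : ℝ≥0∞} (hqp : q ≤ p)
    {f : α → E} (hf : AEStronglyMeasurable f μ) {s : Set α} (hs : MeasurableSet s) :
    eLpNorm (s.indicator f) q μ ≤ eLpNorm f p μ * μ s ^ (1 / q.toReal - 1 / p.toReal) := by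
  rw [eLpNorm_indicator_eq_eLpNorm_restrict hs]
  have h := eLpNorm_le_eLpNorm_mul_rpow_measure_univ (μ := μ.restrict s) hqp hf.restrict
  rw [Measure.restrict_apply_univ] at h
  exact h.trans (by gcongr; exact Measure.restrict_le_self)

theorem eLpNorm_norm_sq_le {p q : ℝ≥0∞} (hqp : 2 * q ≤ p)
    {f : α → E} (hf : AEStronglyMeasurable f μ) :
    eLpNorm (fun x => ‖f x‖ ^ 2) q μ ≤
      (eLpNorm f p μ * μ Set.univ ^ (1 / (2 * q).toReal - 1 / p.toReal)) ^ 2 := by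
  have h := eLpNorm_norm_rpow (p := q) (μ := μ) f (two_pos : (0 : ℝ) < 2)
  simp only [Real.rpow_two, ENNReal.rpow_two, ENNReal.ofReal_ofNat] at h
  rw [h, mul_comm q]
  gcongr
  exact eLpNorm_le_eLpNorm_mul_rpow_measure_univ hqp hf

end Lebesgue

section Superposition

variable {d : ℕ} {α : Type*} [MeasurableSpace α] {μ : Measure α} {φ : α → ℝ}
  {u h : α → EuclideanSpace ℝ (Fin d)}

theorem measurable_ramp (hφ : Measurable φ) {t : α → ℝ} (ht : Measurable t) :
    Measurable fun x => ramp (φ x) (t x) := by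
  unfold ramp
  fun_prop

theorem measurable_rampSlope (hφ : Measurable φ) {t : α → ℝ} (ht : Measurable t) :
    Measurable fun x => rampSlope (φ x) (t x) :=
  (measurable_const.indicator measurableSet_Ioo).comp (ht.sub hφ)

theorem measurable_kinkDist (hφ : Measurable φ) {t : α → ℝ} (ht : Measurable t) :
    Measurable fun x => kinkDist (φ x) (t x) := by
  unfold kinkDist
  refine Measurable.ite ?_ measurable_const ?_
  · exact (measurableSet_eq_fun ht hφ).union (measurableSet_eq_fun ht (hφ.add_const 1))
  · exact ((ht.sub hφ).abs).min (((ht.sub hφ).sub_const 1).abs)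

theorem measurable_Pvec (hφ : Measurable φ) (hu : Measurable u) :
    Measurable fun x => Pvec (φ x) (u x) := by
  simp only [Pvec_eq]
  exact (measurable_ramp hφ hu.norm).smul (hu.norm.inv.smul hu)

theorem measurable_GPvec (hφ : Measurable φ) (hu : Measurable u) (hh : Measurable h) :
    Measurable fun x => GPvec (φ x) (u x) (h x) := by
  simp only [GPvec_eq]
  have hproj : Measurable fun x => (⟪u x, h x⟫ / ‖u x‖ ^ 2) • u x :=
    ((hu.inner hh).div (hu.norm.pow_const 2)).smul hu
  exact ((measurable_rampSlope hφ hu.norm).smul hproj).add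
    ((measurable_ramp hφ hu.norm).smul (hu.norm.inv.smul (hh.sub hproj)))

theorem memLp_Pvec [IsFiniteMeasure μ] (hφ : Measurable φ) (hu : Measurable u) (q : ℝ≥0∞) :
    MemLp (fun x => Pvec (φ x) (u x)) q μ :=
  MemLp.of_bound (measurable_Pvec hφ hu).aestronglyMeasurable 1
    (Filter.Eventually.of_forall fun _ => norm_Pvec_le_one _ _)

theorem memLp_GPvec [IsFiniteMeasure μ] {ν : ℝ} (hν : 0 < ν) (hφ : Measurable φ)
    (hφν : ∀ᵐ x ∂μ, ν ≤ φ x) (hu : Measurable u) (hh : Measurable h)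
    {p q : ℝ≥0∞} (hqp : q ≤ p) (hhp : MemLp h p μ) :
    MemLp (fun x => GPvec (φ x) (u x) (h x)) q μ :=
  (hhp.mono_exponent hqp).of_le_mul (measurable_GPvec hφ hu hh).aestronglyMeasurable
    (hφν.mono fun _ hx => norm_GPvec_le hν hx _ _)

/-- The superposition operator `u ↦ Pvec (φ ·) (u ·)` from `L^p` to `L^q`. -/
noncomputable def PvecLp [IsFiniteMeasure μ] (hφ : Measurable φ) {p : ℝ≥0∞} (q : ℝ≥0∞)
    (u : Lp (EuclideanSpace ℝ (Fin d)) p μ) : Lp (EuclideanSpace ℝ (Fin d)) q μ :=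
  (memLp_Pvec hφ (Lp.stronglyMeasurable u).measurable q).toLp _

theorem coeFn_PvecLp [IsFiniteMeasure μ] (hφ : Measurable φ) {p : ℝ≥0∞} (q : ℝ≥0∞)
    (u : Lp (EuclideanSpace ℝ (Fin d)) p μ) :
    ⇑(PvecLp hφ q u) =ᵐ[μ] fun x => Pvec (φ x) (u x) :=
  MemLp.coeFn_toLp _

/-- The linearized superposition operator at `u`, as a linear map `L^p → L^q`. -/
noncomputable def GPvecLinear [IsFiniteMeasure μ] {ν : ℝ} (hν : 0 < ν) (hφ : Measurable φ)
    (hφν : ∀ᵐ x ∂μ, ν ≤ φ x) (hu : Measurable u) {p q : ℝ≥0∞} (hqp : q ≤ p) :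
    Lp (EuclideanSpace ℝ (Fin d)) p μ →ₗ[ℝ] Lp (EuclideanSpace ℝ (Fin d)) q μ where
  toFun h := (memLp_GPvec hν hφ hφν hu (Lp.stronglyMeasurable h).measurable hqp
    (Lp.memLp h)).toLp _
  map_add' h k := by
    rw [← MemLp.toLp_add]
    refine (MemLp.toLp_eq_toLp_iff _ _).2 ?_
    filter_upwards [Lp.coeFn_add h k] with x hx
    rw [hx, Pi.add_apply, Pi.add_apply, GPvec_add]
  map_smul' r h := by
    rw [RingHom.id_apply, ← MemLp.toLp_const_smul]
    refine (MemLp.toLp_eq_toLp_iff _ _).2 ?_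
    filter_upwards [Lp.coeFn_smul r h] with x hx
    rw [hx, Pi.smul_apply, Pi.smul_apply, GPvec_smul]

theorem coeFn_GPvecLinear [IsFiniteMeasure μ] {ν : ℝ} (hν : 0 < ν) (hφ : Measurable φ)
    (hφν : ∀ᵐ x ∂μ, ν ≤ φ x) (hu : Measurable u) {p q : ℝ≥0∞} (hqp : q ≤ p)
    (h : Lp (EuclideanSpace ℝ (Fin d)) p μ) :
    ⇑(GPvecLinear hν hφ hφν hu hqp h) =ᵐ[μ] fun x => GPvec (φ x) (u x) (h x) :=
  MemLp.coeFn_toLp (memLp_GPvec hν hφ hφν hu (Lp.stronglyMeasurable h).measurable hqp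
    (Lp.memLp h))

/-- The linearized superposition operator at `u`, as a bounded operator `L^p → L^q`. -/
noncomputable def GPvecL [IsFiniteMeasure μ] {ν : ℝ} (hν : 0 < ν) (hφ : Measurable φ)
    (hφν : ∀ᵐ x ∂μ, ν ≤ φ x) (hu : Measurable u)
    {p q : ℝ≥0∞} [Fact (1 ≤ p)] [Fact (1 ≤ q)] (hqp : q ≤ p) (hp : p ≠ ⊤) :
    Lp (EuclideanSpace ℝ (Fin d)) p μ →L[ℝ] Lp (EuclideanSpace ℝ (Fin d)) q μ :=
  LinearMap.mkContinuous (GPvecLinear hν hφ hφν hu hqp)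
    ((1 + 2 / ν) * (μ Set.univ ^ (1 / q.toReal - 1 / p.toReal)).toReal)
    (fun h => by
      have hexp : 0 ≤ 1 / q.toReal - 1 / p.toReal := by
        rw [sub_nonneg]
        exact one_div_le_one_div_of_le (ENNReal.toReal_pos
          (zero_lt_one.trans_le (Fact.out : 1 ≤ q)).ne' (ne_top_of_le_ne_top hp hqp))
          (ENNReal.toReal_mono hp hqp)
      have hle : eLpNorm (fun x => GPvec (φ x) (u x) (h x)) q μ ≤
          ENNReal.ofReal (1 + 2 / ν) *
            (eLpNorm h p μ * μ Set.univ ^ (1 / q.toReal - 1 / p.toReal)) :=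
        (eLpNorm_le_mul_eLpNorm_of_ae_le_mul
          (hφν.mono fun _ hx => norm_GPvec_le hν hx _ _) q).trans (by
            gcongr
            exact eLpNorm_le_eLpNorm_mul_rpow_measure_univ hqp (Lp.aestronglyMeasurable h))
      rw [Lp.norm_def, Lp.norm_def, eLpNorm_congr_ae (coeFn_GPvecLinear hν hφ hφν hu hqp h)]
      refine (ENNReal.toReal_mono (ENNReal.mul_ne_top ENNReal.ofReal_ne_top
        (ENNReal.mul_ne_top (Lp.eLpNorm_ne_top h)
          (ENNReal.rpow_ne_top_of_nonneg hexp (measure_ne_top _ _)))) hle).trans_eq ?_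
      rw [ENNReal.toReal_mul, ENNReal.toReal_mul, ENNReal.toReal_ofReal (by positivity)]
      ring)

theorem coeFn_GPvecL [IsFiniteMeasure μ] {ν : ℝ} (hν : 0 < ν) (hφ : Measurable φ)
    (hφν : ∀ᵐ x ∂μ, ν ≤ φ x) (hu : Measurable u)
    {p q : ℝ≥0∞} [Fact (1 ≤ p)] [Fact (1 ≤ q)] (hqp : q ≤ p) (hp : p ≠ ⊤)
    (h : Lp (EuclideanSpace ℝ (Fin d)) p μ) :
    ⇑(GPvecL hν hφ hφν hu hqp hp h : Lp (EuclideanSpace ℝ (Fin d)) q μ) =ᵐ[μ]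
      fun x => GPvec (φ x) (u x) (h x) :=
  coeFn_GPvecLinear hν hφ hφν hu hqp h

theorem eLpNorm_Pvec_remainder_le {ν : ℝ} (hν : 0 < ν) (hφ : Measurable φ)
    (hφν : ∀ᵐ x ∂μ, ν ≤ φ x) (hu : Measurable u) (hh : Measurable h)
    {p q : ℝ≥0∞} (hq : 1 ≤ q) (hqp : 2 * q ≤ p) :
    eLpNorm (fun x => Pvec (φ x) (u x + h x) - Pvec (φ x) (u x) -
        GPvec (φ x) (u x + h x) (h x)) q μ ≤
      (ENNReal.ofReal (3 / ν ^ 2 + 3 / ν) *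
          (μ Set.univ ^ (1 / (2 * q).toReal - 1 / p.toReal)) ^ 2 * eLpNorm h p μ +
        2 * μ {x | kinkDist (φ x) ‖u x‖ ≤ ‖h x‖} ^ (1 / q.toReal - 1 / p.toReal)) *
      eLpNorm h p μ := by
  set s : Set α := {x | kinkDist (φ x) ‖u x‖ ≤ ‖h x‖} with hs_def
  have hs : MeasurableSet s := measurableSet_le (measurable_kinkDist hφ hu.norm) hh.norm
  set C : ℝ := 3 / ν ^ 2 + 3 / ν with hC_def
  have hC : 0 ≤ C := by positivity
  have hq2 : q ≤ 2 * q := by rw [two_mul]; exact le_self_add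
  have hsq : AEStronglyMeasurable (C • fun x => ‖h x‖ ^ 2) μ :=
    ((hh.norm.pow_const 2).const_smul C).aestronglyMeasurable
  have hind : AEStronglyMeasurable ((2 : ℝ) • s.indicator fun x => ‖h x‖) μ :=
    ((hh.norm.indicator hs).const_smul (2 : ℝ)).aestronglyMeasurable
  calc _ ≤ eLpNorm ((C • fun x => ‖h x‖ ^ 2) + (2 : ℝ) • s.indicator fun x => ‖h x‖) q μ := by
        refine eLpNorm_mono_ae_real (hφν.mono fun x hx => ?_)
        refine (norm_Pvec_remainder_le hν hx (u x) (h x)).trans_eq ?_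
        simp [Set.indicator_apply, s, C]
    _ ≤ ‖C‖ₑ * (eLpNorm h p μ * μ Set.univ ^ (1 / (2 * q).toReal - 1 / p.toReal)) ^ 2 +
        ‖(2 : ℝ)‖ₑ * (eLpNorm h p μ * μ s ^ (1 / q.toReal - 1 / p.toReal)) := by
        refine (eLpNorm_add_le hsq hind hq).trans ?_
        rw [eLpNorm_const_smul, eLpNorm_const_smul]
        gcongr
        · exact eLpNorm_norm_sq_le hqp hh.aestronglyMeasurable
        · refine (eLpNorm_indicator_le_mul_measure_rpow (hq2.trans hqp)
            hh.norm.aestronglyMeasurable hs).trans_eq ?_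
          rw [eLpNorm_norm]
    _ = _ := by
        rw [Real.enorm_of_nonneg hC, Real.enorm_of_nonneg zero_le_two, ENNReal.ofReal_ofNat]
        ring

end Superposition

/-- for `Ω ⊂ ℝ^d` of finite measure, `φ ≥ ν > 0` a.e. and
`2 ≤ 2q ≤ p < ∞`, the superposition operator `P(u)(x) = P_x(u(x))` is well
defined from `L^p(Ω; ℝ^d)` to `L^q(Ω; ℝ^d)` and Newton differentiable there,
with Newton derivative given pointwise by `G_P`, each `G_P(u)` being a bounded
linear operator from `L^p(Ω; ℝ^d)` to `L^q(Ω; ℝ^d)`. -/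
theorem P_superposition_newton_diff
    (d : ℕ) (Ω : Set (EuclideanSpace ℝ (Fin d))) (hΩ : MeasurableSet Ω)
    (hΩfin : volume Ω < ⊤)
    (ν : ℝ) (hν : 0 < ν)
    (φ : EuclideanSpace ℝ (Fin d) → ℝ) (hφm : Measurable φ)
    (hφν : ∀ᵐ x ∂(volume.restrict Ω), ν ≤ φ x)
    (p q : ℝ≥0∞) [Fact (1 ≤ p)] [Fact (1 ≤ q)]
    (h2q : 2 ≤ 2 * q) (hqp : 2 * q ≤ p) (hp : p ≠ ⊤) :
    ∃ (P : Lp (EuclideanSpace ℝ (Fin d)) p (volume.restrict Ω) →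
          Lp (EuclideanSpace ℝ (Fin d)) q (volume.restrict Ω))
      (G : Lp (EuclideanSpace ℝ (Fin d)) p (volume.restrict Ω) →
          (Lp (EuclideanSpace ℝ (Fin d)) p (volume.restrict Ω) →L[ℝ]
            Lp (EuclideanSpace ℝ (Fin d)) q (volume.restrict Ω))),
      (∀ u, ⇑(P u) =ᵐ[volume.restrict Ω] fun x => Pvec (φ x) (u x)) ∧
      (∀ u h, ⇑(G u h) =ᵐ[volume.restrict Ω] fun x => GPvec (φ x) (u x) (h x)) ∧
      (∀ u, ∀ ε > 0, ∃ δ > 0, ∀ h, ‖h‖ < δ →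
        ‖P (u + h) - P u - G (u + h) h‖ ≤ ε * ‖h‖) := by
  have : IsFiniteMeasure (volume.restrict Ω) := ⟨by rwa [Measure.restrict_apply_univ]⟩
  have hq1 : 1 ≤ q := Fact.out
  have hq2 : q ≤ 2 * q := by rw [two_mul]; exact le_self_add
  have hq'p : q ≤ p := hq2.trans hqp
  have hqt : q ≠ ⊤ := ne_top_of_le_ne_top hp hq'p
  have hqr : 0 < q.toReal := ENNReal.toReal_pos (zero_lt_one.trans_le hq1).ne' hqt
  have hpr : 2 * q.toReal ≤ p.toReal := by
    simpa [ENNReal.toReal_mul] using ENNReal.toReal_mono hp hqp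
  have hexp : 0 < 1 / q.toReal - 1 / p.toReal :=
    sub_pos.2 (one_div_lt_one_div_of_lt hqr (by linarith))
  have hexp2 : 0 ≤ 1 / (2 * q).toReal - 1 / p.toReal := by
    rw [sub_nonneg, ENNReal.toReal_mul]
    exact one_div_le_one_div_of_le (by simpa using hqr) (by simpa using hpr)
  have hm (u : Lp (EuclideanSpace ℝ (Fin d)) p (volume.restrict Ω)) : Measurable u :=
    (Lp.stronglyMeasurable u).measurable
  refine ⟨PvecLp hφm q,
    fun u => GPvecL hν hφm hφν (hm u) hq'p hp,
    coeFn_PvecLp hφm q, fun u h => coeFn_GPvecL hν hφm hφν (hm u) hq'p hp h, ?_⟩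
  intro u ε hε
  have hlim : Filter.Tendsto (fun h : Lp (EuclideanSpace ℝ (Fin d)) p (volume.restrict Ω) =>
      ENNReal.ofReal (3 / ν ^ 2 + 3 / ν) *
          ((volume.restrict Ω) Set.univ ^ (1 / (2 * q).toReal - 1 / p.toReal)) ^ 2 * ‖h‖ₑ +
        2 * (volume.restrict Ω) {x | kinkDist (φ x) ‖u x‖ ≤ ‖h x‖} ^
          (1 / q.toReal - 1 / p.toReal)) (nhds 0) (nhds 0) := by
    have h₁ := ENNReal.Tendsto.const_mul
      (a := ENNReal.ofReal (3 / ν ^ 2 + 3 / ν) *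
          ((volume.restrict Ω) Set.univ ^ (1 / (2 * q).toReal - 1 / p.toReal)) ^ 2)
      ((continuous_enorm (E := Lp (EuclideanSpace ℝ (Fin d)) p (volume.restrict Ω))).tendsto 0)
      (Or.inr (ENNReal.mul_ne_top ENNReal.ofReal_ne_top (ENNReal.pow_ne_top
        (ENNReal.rpow_ne_top_of_nonneg hexp2 (measure_ne_top _ _)))))
    have h₂ := ((ENNReal.continuous_rpow_const (y := 1 / q.toReal - 1 / p.toReal)).tendsto
      0).comp (tendsto_measure_le_norm_Lp (E := EuclideanSpace ℝ (Fin d))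
        (μ := volume.restrict Ω) hp
        (measurable_kinkDist hφm (hm u).norm) (fun x => kinkDist_pos _ _))
    rw [ENNReal.zero_rpow_of_pos hexp] at h₂
    simpa only [Function.comp_def, enorm_zero, mul_zero, add_zero] using
      h₁.add (ENNReal.Tendsto.const_mul (a := 2) h₂ (Or.inr ENNReal.ofNat_ne_top))
  obtain ⟨δ, hδ, hδε⟩ := Metric.eventually_nhds_iff.1
    (ENNReal.tendsto_nhds_zero.1 hlim (ENNReal.ofReal ε) (ENNReal.ofReal_pos.2 hε))
  refine ⟨δ, hδ, fun h hh => ?_⟩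
  have hle := hδε (by rwa [dist_zero_right])
  have hae : ⇑(PvecLp hφm q (u + h) - PvecLp hφm q u -
      (GPvecL hν hφm hφν (hm (u + h)) hq'p hp h :
        Lp (EuclideanSpace ℝ (Fin d)) q (volume.restrict Ω))) =ᵐ[volume.restrict Ω]
      fun x => Pvec (φ x) (u x + h x) - Pvec (φ x) (u x) - GPvec (φ x) (u x + h x) (h x) := by
    refine (Lp.coeFn_sub _ _).trans ?_
    filter_upwards [Lp.coeFn_sub (PvecLp hφm q (u + h)) (PvecLp hφm q u),
      coeFn_PvecLp hφm q (u + h), coeFn_PvecLp hφm q u,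
      coeFn_GPvecL (q := q) hν hφm hφν (hm (u + h)) hq'p hp h, Lp.coeFn_add u h]
      with x h₁ h₂ h₃ h₄ h₅
    rw [Pi.sub_apply, h₁, Pi.sub_apply, h₂, h₃, h₄, h₅, Pi.add_apply]
  have hfin := eLpNorm_Pvec_remainder_le hν hφm hφν (hm u) (hm h) hq1 hqp
  rw [← eLpNorm_congr_ae hae, ← Lp.enorm_def, ← Lp.enorm_def] at hfin
  replace hfin := hfin.trans (show _ ≤ ENNReal.ofReal ε * ‖h‖ₑ by gcongr)
  rw [← ofReal_norm, ← ofReal_norm, ← ENNReal.ofReal_mul hε.le] at hfin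
  exact (ENNReal.ofReal_le_ofReal_iff (by positivity)).1 hfin
end

section
/- Let Y be a real normed space, H a real Hilbert space, and u^d ∈ H. Let S : Y → H be Newton differentiable at every point with Newton derivative G_S : Y → L(Y, H), and assume G_S is locally bounded (for each f ∈ Y there are r, C > 0 with ‖G_S(g)‖ ≤ C for all g with ‖g − f‖_Y < r). Let λ ≥ 0 and let N : Y → ℝ be Newton differentiable at every point with Newton derivative G_N : Y → L(Y, ℝ). Then the reduced functional J : Y → ℝ, J(f) := (1/2)‖S(f) − u^d‖_H² + λ N(f), is Newton differentiable at every point, with Newton derivative f ↦ ( h ↦ ⟨S(f) − u^d, G_S(f)h⟩_H + λ G_N(f)h ). -/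
open RealInnerProductSpace

/-- Newton differentiability of the reduced tracking functional
`J(f) = (1/2)‖S(f) − u^d‖² + λ N(f)`, where `S` is Newton differentiable with
locally bounded Newton derivative `G_S` and `N` is Newton differentiable with
Newton derivative `G_N`. The Newton derivative of `J` is
`f ↦ (h ↦ ⟨S(f) − u^d, G_S(f)h⟩ + λ G_N(f)h)`. -/
theorem reduced_functional_newton_diff
    {Y H : Type*} [NormedAddCommGroup Y] [NormedSpace ℝ Y]
    [NormedAddCommGroup H] [InnerProductSpace ℝ H] [CompleteSpace H]
    (ud : H) (S : Y → H) (GS : Y → (Y →L[ℝ] H))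
    (hS : ∀ f : Y, ∀ ε > 0, ∃ δ > 0, ∀ h : Y, ‖h‖ < δ →
      ‖S (f + h) - S f - GS (f + h) h‖ ≤ ε * ‖h‖)
    (hGSbdd : ∀ f : Y, ∃ r > 0, ∃ C > 0, ∀ g : Y, ‖g - f‖ < r → ‖GS g‖ ≤ C)
    (lam : ℝ) (hlam : 0 ≤ lam)
    (N : Y → ℝ) (GN : Y → (Y →L[ℝ] ℝ))
    (hN : ∀ f : Y, ∀ ε > 0, ∃ δ > 0, ∀ h : Y, ‖h‖ < δ →
      ‖N (f + h) - N f - GN (f + h) h‖ ≤ ε * ‖h‖) :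
    ∀ f : Y, ∀ ε > 0, ∃ δ > 0, ∀ h : Y, ‖h‖ < δ →
      |((1 / 2) * ‖S (f + h) - ud‖ ^ 2 + lam * N (f + h))
          - ((1 / 2) * ‖S f - ud‖ ^ 2 + lam * N f)
          - (⟪S (f + h) - ud, GS (f + h) h⟫ + lam * GN (f + h) h)|
        ≤ ε * ‖h‖ := by
  intro f ε hε
  obtain ⟨r, hr, C, hC, hbdd⟩ := hGSbdd f
  set K : ℝ := ‖S f - ud‖ + (1 + C) with hK
  have hKpos : 0 < K := by positivity
  obtain ⟨δ₁, hδ₁, h₁⟩ := hS f 1 one_pos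
  obtain ⟨δ₂, hδ₂, h₂⟩ := hS f (ε / (4 * K)) (by positivity)
  obtain ⟨δ₃, hδ₃, h₃⟩ := hN f (ε / (4 * (lam + 1))) (by positivity)
  refine ⟨min (min r 1) (min (min δ₁ δ₂) (min δ₃ (ε / (2 * (1 + C) ^ 2)))), by positivity, ?_⟩
  intro h hh
  simp only [lt_min_iff] at hh
  obtain ⟨⟨hhr, hh1⟩, ⟨hhδ₁, hhδ₂⟩, hhδ₃, hhε⟩ := hh
  specialize h₁ h hhδ₁
  specialize h₂ h hhδ₂
  specialize h₃ h hhδ₃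
  have hGS : ‖GS (f + h) h‖ ≤ C * ‖h‖ :=
    (GS (f + h)).le_of_opNorm_le (hbdd (f + h) (by simpa using hhr)) h
  have hd : ‖S (f + h) - S f‖ ≤ (1 + C) * ‖h‖ := by
    have := norm_le_norm_sub_add (S (f + h) - S f) (GS (f + h) h)
    linarith
  have hb : ‖S (f + h) - ud‖ ≤ K := by
    have := norm_sub_le_norm_sub_add_norm_sub (S (f + h)) (S f) ud
    nlinarith
  have hident : ((1 / 2) * ‖S (f + h) - ud‖ ^ 2 + lam * N (f + h))
      - ((1 / 2) * ‖S f - ud‖ ^ 2 + lam * N f)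
      - (⟪S (f + h) - ud, GS (f + h) h⟫ + lam * GN (f + h) h)
      = ⟪S (f + h) - ud, S (f + h) - S f - GS (f + h) h⟫
        - (1 / 2) * ‖S (f + h) - S f‖ ^ 2
        + lam * (N (f + h) - N f - GN (f + h) h) := by
    have hsq := norm_sub_sq_real (S (f + h) - ud) (S (f + h) - S f)
    rw [sub_sub_sub_cancel_left] at hsq
    rw [inner_sub_right, hsq]
    ring
  have hinner : |⟪S (f + h) - ud, S (f + h) - S f - GS (f + h) h⟫| ≤ ε / 4 * ‖h‖ :=
    calc _ ≤ ‖S (f + h) - ud‖ * ‖S (f + h) - S f - GS (f + h) h‖ := abs_real_inner_le_norm _ _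
      _ ≤ K * (ε / (4 * K) * ‖h‖) := by gcongr
      _ = ε / 4 * ‖h‖ := by field_simp
  have hquad : (1 / 2) * ‖S (f + h) - S f‖ ^ 2 ≤ ε / 4 * ‖h‖ :=
    calc _ ≤ (1 / 2) * ((1 + C) * ‖h‖) ^ 2 := by gcongr
      _ = (1 / 2) * (1 + C) ^ 2 * ‖h‖ * ‖h‖ := by ring
      _ ≤ (1 / 2) * (1 + C) ^ 2 * (ε / (2 * (1 + C) ^ 2)) * ‖h‖ := by gcongr
      _ = ε / 4 * ‖h‖ := by field_simp; ring
  have hreg : |lam * (N (f + h) - N f - GN (f + h) h)| ≤ ε / 4 * ‖h‖ :=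
    calc _ = lam * ‖N (f + h) - N f - GN (f + h) h‖ := by
          rw [abs_mul, abs_of_nonneg hlam, Real.norm_eq_abs]
      _ ≤ (lam + 1) * (ε / (4 * (lam + 1)) * ‖h‖) := by gcongr; linarith
      _ = ε / 4 * ‖h‖ := by field_simp
  have hquad_nonneg : 0 ≤ (1 / 2) * ‖S (f + h) - S f‖ ^ 2 := by positivity
  have hεh : 0 ≤ ε * ‖h‖ := by positivity
  rw [hident]
  rw [abs_le] at hinner hreg ⊢
  constructor <;> linarith
end

section
/- Let ν > 0 and φ ≥ ν be real numbers, and let a, a' ∈ ℝ^d be nonzero vectors. Then ‖ a/|a| − a'/|a'| ‖ · | (|a| − φ)^± − (|a'| − φ)^± | ≤ (2/ν) |a − a'|², where t^± := min(1, max(0, t)). -/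
theorem norm_mul_norm_normalize_sub_le {E : Type*} [NormedAddCommGroup E] [NormedSpace ℝ E]
    {a b : E} (ha : a ≠ 0) (hb : b ≠ 0) :
    ‖a‖ * ‖‖a‖⁻¹ • a - ‖b‖⁻¹ • b‖ ≤ 2 * ‖a - b‖ := by
  have ha0 : ‖a‖ ≠ 0 := norm_ne_zero_iff.mpr ha
  have hb0 : ‖b‖ ≠ 0 := norm_ne_zero_iff.mpr hb
  have key : ‖a‖ • (‖a‖⁻¹ • a - ‖b‖⁻¹ • b) = (a - b) + (‖b‖ - ‖a‖) • (‖b‖⁻¹ • b) := by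
    rw [smul_sub, sub_smul, smul_inv_smul₀ ha0, smul_inv_smul₀ hb0]
    abel
  have hunit : ‖‖b‖⁻¹ • b‖ = 1 := by
    rw [norm_smul, norm_inv, norm_norm, inv_mul_cancel₀ hb0]
  calc ‖a‖ * ‖‖a‖⁻¹ • a - ‖b‖⁻¹ • b‖ = ‖(a - b) + (‖b‖ - ‖a‖) • (‖b‖⁻¹ • b)‖ := by
        rw [← key, norm_smul, norm_norm]
    _ ≤ ‖a - b‖ + |‖b‖ - ‖a‖| := by
        refine (norm_add_le _ _).trans_eq ?_
        rw [norm_smul, hunit, mul_one, Real.norm_eq_abs]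
    _ ≤ 2 * ‖a - b‖ := by
        have h := abs_norm_sub_norm_le b a
        rw [norm_sub_rev b a] at h
        linarith

theorem abs_clamp_sub_clamp_le (s t : ℝ) :
    |min 1 (max 0 s) - min 1 (max 0 t)| ≤ |s - t| := by
  grind

/-- for `φ ≥ ν > 0` and nonzero `a, a' ∈ ℝ^d`, the product of
`‖a/|a| − a'/|a'|‖` and `|(|a| − φ)^± − (|a'| − φ)^±|` is bounded by
`(2/ν)|a − a'|²`, where `t^± = min(1, max(0, t))`. -/
theorem product_bound
    (d : ℕ) (ν φ : ℝ) (hν : 0 < ν) (hφ : ν ≤ φ)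
    (a a' : EuclideanSpace ℝ (Fin d)) (ha : a ≠ 0) (ha' : a' ≠ 0) :
    ‖‖a‖⁻¹ • a - ‖a'‖⁻¹ • a'‖ * |min 1 (max 0 (‖a‖ - φ)) - min 1 (max 0 (‖a'‖ - φ))|
      ≤ (2 / ν) * ‖a - a'‖ ^ 2 := by
  have hclamp : |min 1 (max 0 (‖a‖ - φ)) - min 1 (max 0 (‖a'‖ - φ))| ≤ ‖a - a'‖ := by
    refine (abs_clamp_sub_clamp_le _ _).trans ?_
    rw [sub_sub_sub_cancel_right]
    exact abs_norm_sub_norm_le a a'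
  by_cases hsmall : ‖a‖ ≤ φ ∧ ‖a'‖ ≤ φ
  · rw [max_eq_left (sub_nonpos.mpr hsmall.1), max_eq_left (sub_nonpos.mpr hsmall.2), sub_self,
      abs_zero, mul_zero]
    positivity
  · have hν_mul : ν * ‖‖a‖⁻¹ • a - ‖a'‖⁻¹ • a'‖ ≤ 2 * ‖a - a'‖ := by
      rcases not_and_or.mp hsmall with h | h
      · exact (mul_le_mul_of_nonneg_right (hφ.trans (not_le.mp h).le) (norm_nonneg _)).trans
          (norm_mul_norm_normalize_sub_le ha ha')
      · rw [norm_sub_rev (‖a‖⁻¹ • a), norm_sub_rev a]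
        exact (mul_le_mul_of_nonneg_right (hφ.trans (not_le.mp h).le) (norm_nonneg _)).trans
          (norm_mul_norm_normalize_sub_le ha' ha)
    have hdir : ‖‖a‖⁻¹ • a - ‖a'‖⁻¹ • a'‖ ≤ 2 / ν * ‖a - a'‖ := by
      rw [div_mul_eq_mul_div, le_div_iff₀' hν]
      exact hν_mul
    calc _ ≤ (2 / ν * ‖a - a'‖) * ‖a - a'‖ := by gcongr
      _ = 2 / ν * ‖a - a'‖ ^ 2 := by ring
end
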